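/- arXiv:2004.14186 — 2 statements merged into one kernel-verified Lean document; each statement's English description precedes it below -/
import Mathlib

section
/- Let Λ be a ring and R = (Λ 0; Λ Λ) the triangular matrix ring with M = Λ the regular (Λ,Λ)-bimodule, so that right R-modules are triples (X, Y)_f with X, Y right Λ-modules and f : Y ≅ Y ⊗_Λ Λ → X a Λ-homomorphism. For right Λ-modules X and Y, the right R-module (X, 0) ⊕ (Y, Y)_{id} is a silting R-module if and only if both X and Y are silting right Λ-modules and Y ∈ Gen X. -/
set_option linter.unusedSectionVars false

/-!
Framework for right modules over the triangular matrix ring `R = (Λ 0; Λ Λ)`.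
Right `S`-modules are encoded as modules over the opposite ring `Sᵐᵒᵖ`.  Using the
identification `Y ⊗_Λ Λ ≅ Y`, a right `R`-module is encoded as a triple `(X, Y)_f`
where `X`, `Y` are right `Λ`-modules and `f : Y → X` is `Λ`-linear (`TPair`), with
morphisms `(α, β)` satisfying `α ∘ f = f' ∘ β`.
-/

open Function

universe u

section LightTriangular

variable (Λ : Type u) [Ring Λ]

/-- A triple `(X, Y)_f` with `f : Y → X` a homomorphism of right `Λ`-modules:
an object of the category of right modules over `R = (Λ 0; Λ Λ)`. -/
structure TPair : Type (u + 1) where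
  car₁ : Type u
  car₂ : Type u
  [ag₁ : AddCommGroup car₁]
  [mod₁ : Module Λᵐᵒᵖ car₁]
  [ag₂ : AddCommGroup car₂]
  [mod₂ : Module Λᵐᵒᵖ car₂]
  str : car₂ →ₗ[Λᵐᵒᵖ] car₁

attribute [instance] TPair.ag₁ TPair.mod₁ TPair.ag₂ TPair.mod₂

/-- A homomorphism of triples (right `R`-modules): a pair `(α, β)` with
`α ∘ f = f' ∘ β`. -/
structure TPairHom (A B : TPair Λ) : Type u where
  h₁ : A.car₁ →ₗ[Λᵐᵒᵖ] B.car₁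
  h₂ : A.car₂ →ₗ[Λᵐᵒᵖ] B.car₂
  comm : ∀ y, h₁ (A.str y) = B.str (h₂ y)

variable {Λ}

/-- Composition of homomorphisms of triples. -/
def TPairHom.comp {A B C : TPair Λ} (g : TPairHom Λ B C) (f : TPairHom Λ A B) :
    TPairHom Λ A C where
  h₁ := g.h₁.comp f.h₁
  h₂ := g.h₂.comp f.h₂
  comm y := by simp only [LinearMap.comp_apply, f.comm, g.comm]

/-- The identity homomorphism of a triple. -/
def TPairHom.id (A : TPair Λ) : TPairHom Λ A A :=
  ⟨LinearMap.id, LinearMap.id, fun _ => rfl⟩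

/-- `D_σ` for a homomorphism `σ : P₁ → P₀` of (right) `S`-modules: the class of modules
`A` such that `Hom_S(σ, A)` is surjective. -/
def DMod {S : Type u} [Ring S] {P₁ P₀ : Type u} [AddCommGroup P₁] [Module S P₁]
    [AddCommGroup P₀] [Module S P₀] (σ : P₁ →ₗ[S] P₀)
    (A : Type u) [AddCommGroup A] [Module S A] : Prop :=
  ∀ g : P₁ →ₗ[S] A, ∃ g' : P₀ →ₗ[S] A, g'.comp σ = g

/-- `D_σ` for a homomorphism of triples (right `R`-modules). -/
def DTPair {P₁ P₀ : TPair Λ} (σ : TPairHom Λ P₁ P₀) (A : TPair Λ) : Prop :=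
  ∀ φ : TPairHom Λ P₁ A, ∃ ψ : TPairHom Λ P₀ A, ψ.comp σ = φ

/-- `A ∈ Gen T` for right `S`-modules: `A` is an epimorphic image of a direct sum of
copies of `T`. -/
def GenMod (S : Type u) [Ring S] (T : Type u) [AddCommGroup T] [Module S T]
    (A : Type u) [AddCommGroup A] [Module S A] : Prop :=
  ∃ (ι : Type u) (φ : (ι →₀ T) →ₗ[S] A), Surjective φ

/-- The direct sum of `ι` copies of a triple. -/
noncomputable def copiesTPair (T : TPair Λ) (ι : Type u) : TPair Λ :=
  ⟨ι →₀ T.car₁, ι →₀ T.car₂, Finsupp.mapRange.linearMap T.str⟩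

/-- `A ∈ Gen T` for triples (right `R`-modules). -/
def GenTPair (T A : TPair Λ) : Prop :=
  ∃ (ι : Type u) (φ : TPairHom Λ (copiesTPair T ι) A), Surjective φ.h₁ ∧ Surjective φ.h₂

/-- Projectivity of a triple (categorical projectivity in the category of right
`R`-modules; epimorphisms are componentwise surjections). -/
def TPairProjective (P : TPair Λ) : Prop :=
  ∀ (B C : TPair Λ) (g : TPairHom Λ B C), Surjective g.h₁ → Surjective g.h₂ →
    ∀ φ : TPairHom Λ P C, ∃ ψ : TPairHom Λ P B, g.comp ψ = φ

/-- A silting right `S`-module: `T` admits a projective presentation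
`P₁ →σ P₀ →π T → 0` with `Gen T = D_σ`. -/
def IsSiltingMod (S : Type u) [Ring S] (T : Type u) [AddCommGroup T] [Module S T] : Prop :=
  ∃ (P₁ P₀ : ModuleCat.{u} S) (σ : ↥P₁ →ₗ[S] ↥P₀) (π : ↥P₀ →ₗ[S] T),
    Module.Projective S P₁ ∧ Module.Projective S P₀ ∧
    Surjective π ∧ Function.Exact σ π ∧
    ∀ (A : Type u) [AddCommGroup A] [Module S A], (GenMod S T A ↔ DMod σ A)

/-- A silting triple (right `R`-module). -/
def IsSiltingTPair (T : TPair Λ) : Prop :=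
  ∃ (P₁ P₀ : TPair Λ) (σ : TPairHom Λ P₁ P₀) (π : TPairHom Λ P₀ T),
    TPairProjective P₁ ∧ TPairProjective P₀ ∧
    Surjective π.h₁ ∧ Surjective π.h₂ ∧
    Function.Exact σ.h₁ π.h₁ ∧ Function.Exact σ.h₂ π.h₂ ∧
    ∀ A : TPair Λ, (GenTPair T A ↔ DTPair σ A)

/-- `Ext¹_S(T, N) = 0`, expressed by the splitting of all short exact sequences
`0 → N → E → T → 0`. -/
def Ext1VanishMod (S : Type u) [Ring S] (T N : Type u) [AddCommGroup T] [Module S T]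
    [AddCommGroup N] [Module S N] : Prop :=
  ∀ (E : Type u) [AddCommGroup E] [Module S E] (i : N →ₗ[S] E) (p : E →ₗ[S] T),
    Injective i → Surjective p → Function.Exact i p →
    ∃ s : T →ₗ[S] E, p.comp s = LinearMap.id

/-- A tilting right `S`-module: `Gen T = {N ∣ Ext¹_S(T, N) = 0}`. -/
def IsTiltingMod (S : Type u) [Ring S] (T : Type u) [AddCommGroup T] [Module S T] : Prop :=
  ∀ (N : Type u) [AddCommGroup N] [Module S N], GenMod S T N ↔ Ext1VanishMod S T N

/-- `Ext¹_R(T, N) = 0` for triples, expressed by the splitting of all short exact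
sequences `0 → N → E → T → 0` of triples (monomorphisms, epimorphisms and exactness
are componentwise). -/
def Ext1VanishTPair (T N : TPair Λ) : Prop :=
  ∀ (E : TPair Λ) (i : TPairHom Λ N E) (p : TPairHom Λ E T),
    Injective i.h₁ → Injective i.h₂ → Surjective p.h₁ → Surjective p.h₂ →
    Function.Exact i.h₁ p.h₁ → Function.Exact i.h₂ p.h₂ →
    ∃ s : TPairHom Λ T E, p.comp s = TPairHom.id T

/-- A tilting triple (right `R`-module): `Gen T = {N ∣ Ext¹_R(T, N) = 0}`. -/
def IsTiltingTPair (T : TPair Λ) : Prop :=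
  ∀ N : TPair Λ, GenTPair T N ↔ Ext1VanishTPair T N

variable (Λ)

/-- The triple `(X, 0) ⊕ (Y, Y)_{id}`: first component `X ⊕ Y`, second component `Y`,
structure map `y ↦ (0, y)`. -/
def sumPair (X Y : Type u) [AddCommGroup X] [Module Λᵐᵒᵖ X]
    [AddCommGroup Y] [Module Λᵐᵒᵖ Y] : TPair Λ :=
  ⟨X × Y, Y, LinearMap.prod (0 : Y →ₗ[Λᵐᵒᵖ] X) LinearMap.id⟩

end LightTriangular

section SiltingTriples

variable {Λ : Type u} [Ring Λ]

@[ext]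
theorem TPairHom.ext {A B : TPair Λ} {f g : TPairHom Λ A B} (h₁ : f.h₁ = g.h₁)
    (h₂ : f.h₂ = g.h₂) : f = g := by
  cases f; cases g; cases h₁; cases h₂; rfl

theorem range_finsupp_lsum {S T A ι : Type*} [Ring S] [AddCommGroup T] [Module S T]
    [AddCommGroup A] [Module S A] (f : ι → T →ₗ[S] A) :
    LinearMap.range (Finsupp.lsum ℕ f) = ⨆ i, LinearMap.range (f i) := by
  apply le_antisymm
  · rintro _ ⟨v, rfl⟩
    rw [Finsupp.lsum_apply]
    exact Submodule.sum_mem _ fun i _ =>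
      Submodule.mem_iSup_of_mem i (LinearMap.mem_range_self _ _)
  · refine iSup_le fun i => ?_
    rintro _ ⟨t, rfl⟩
    exact ⟨Finsupp.single i t, by simp⟩

theorem range_le_iSup_range {S : Type*} {ι T A : Type*} [Ring S] [AddCommGroup T] [Module S T]
    [AddCommGroup A] [Module S A] (φ : (ι →₀ T) →ₗ[S] A) :
    LinearMap.range φ ≤ ⨆ f : T →ₗ[S] A, LinearMap.range f := by
  have h : φ = Finsupp.lsum ℕ fun i => φ ∘ₗ Finsupp.lsingle i := by
    ext; simp
  rw [h, range_finsupp_lsum]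
  exact iSup_le fun i => le_iSup (fun f : T →ₗ[S] A => LinearMap.range f) _

/-- A module is generated by `T` iff it is its own trace of `T`. -/
theorem genMod_iff {S : Type u} [Ring S] {T A : Type u} [AddCommGroup T] [Module S T]
    [AddCommGroup A] [Module S A] :
    GenMod S T A ↔ ⨆ f : T →ₗ[S] A, LinearMap.range f = ⊤ := by
  constructor
  · rintro ⟨ι, φ, hφ⟩
    exact top_le_iff.1 ((LinearMap.range_eq_top.2 hφ).ge.trans (range_le_iSup_range φ))
  · intro h
    refine ⟨T →ₗ[S] A, Finsupp.lsum ℕ fun f => f, LinearMap.range_eq_top.1 ?_⟩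
    rw [range_finsupp_lsum, h]

theorem GenMod.range_le {S : Type u} [Ring S] {X Y A : Type u} [AddCommGroup X] [Module S X]
    [AddCommGroup Y] [Module S Y] [AddCommGroup A] [Module S A] (h : GenMod S X Y)
    (g : Y →ₗ[S] A) : LinearMap.range g ≤ ⨆ f : X →ₗ[S] A, LinearMap.range f := by
  rw [LinearMap.range_eq_map, ← genMod_iff.1 h, Submodule.map_iSup]
  refine iSup_le fun f => ?_
  rw [← LinearMap.range_comp]
  exact le_iSup (fun f : X →ₗ[S] A => LinearMap.range f) _

theorem genTPair_refl (T : TPair Λ) : GenTPair T T := by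
  let s (M : Type u) [AddCommGroup M] [Module Λᵐᵒᵖ M] : (PUnit.{u + 1} →₀ M) →ₗ[Λᵐᵒᵖ] M :=
    Finsupp.lsum ℕ fun _ => LinearMap.id
  have hs (M : Type u) [AddCommGroup M] [Module Λᵐᵒᵖ M] : Surjective (s M) :=
    fun m => ⟨Finsupp.single PUnit.unit m, by simp [s]⟩
  have h : s T.car₁ ∘ₗ Finsupp.mapRange.linearMap T.str = T.str ∘ₗ s T.car₂ :=
    Finsupp.lhom_ext fun _ _ => by simp [s]
  exact ⟨PUnit, ⟨s _, s _, LinearMap.congr_fun h⟩, hs _, hs _⟩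

variable {X Y : Type u} [AddCommGroup X] [Module Λᵐᵒᵖ X] [AddCommGroup Y] [Module Λᵐᵒᵖ Y]

/-- The homomorphism out of `(X, 0) ⊕ (Y, Y)_{id}` determined by `X → A₁` and `Y → A₂`. -/
def sumPairDesc {A : TPair Λ} (a : X →ₗ[Λᵐᵒᵖ] A.car₁) (b : Y →ₗ[Λᵐᵒᵖ] A.car₂) :
    TPairHom Λ (sumPair Λ X Y) A where
  h₁ := a.coprod (A.str ∘ₗ b)
  h₂ := b
  comm y := by
    change a 0 + A.str (b y) = A.str (b y)
    rw [map_zero, zero_add]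

/-- The restriction to `X` of a homomorphism out of `(X, 0) ⊕ (Y, Y)_{id}`. -/
def sumPairLeft {A : TPair Λ} (φ : TPairHom Λ (sumPair Λ X Y) A) : X →ₗ[Λᵐᵒᵖ] A.car₁ :=
  LinearMap.comp (M₂ := X × Y) φ.h₁ (LinearMap.inl Λᵐᵒᵖ X Y)

/-- The second component of a homomorphism out of `(X, 0) ⊕ (Y, Y)_{id}`. -/
def sumPairRight {A : TPair Λ} (φ : TPairHom Λ (sumPair Λ X Y) A) : Y →ₗ[Λᵐᵒᵖ] A.car₂ :=
  φ.h₂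

theorem sumPairLeft_desc {A : TPair Λ} (a : X →ₗ[Λᵐᵒᵖ] A.car₁) (b : Y →ₗ[Λᵐᵒᵖ] A.car₂) :
    sumPairLeft (sumPairDesc a b) = a :=
  LinearMap.coprod_inl a (A.str ∘ₗ b)

theorem sumPairDesc_left_right {A : TPair Λ} (φ : TPairHom Λ (sumPair Λ X Y) A) :
    sumPairDesc (sumPairLeft φ) (sumPairRight φ) = φ := by
  refine TPairHom.ext ?_ rfl
  have h : A.str ∘ₗ sumPairRight φ =
      LinearMap.comp (M₂ := X × Y) φ.h₁ (LinearMap.inr Λᵐᵒᵖ X Y) :=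
    LinearMap.ext fun y => (φ.comm y).symm
  change (sumPairLeft φ).coprod (A.str ∘ₗ sumPairRight φ) = φ.h₁
  rw [h]
  exact LinearMap.coprod_comp_inl_inr (M := X) (M₂ := Y) φ.h₁

theorem genTPair_sumPair_iff {A : TPair Λ} :
    GenTPair (sumPair Λ X Y) A ↔ GenMod Λᵐᵒᵖ Y A.car₂ ∧
      (⨆ f : X →ₗ[Λᵐᵒᵖ] A.car₁, LinearMap.range f) ⊔ LinearMap.range A.str = ⊤ := by
  constructor
  · rintro ⟨ι, φ, h₁, h₂⟩
    refine ⟨⟨ι, φ.h₂, h₂⟩, eq_top_iff.2 fun a _ => ?_⟩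
    obtain ⟨v, rfl⟩ := h₁ a
    let v' : ι →₀ X × Y := v
    let φ₁ : (ι →₀ X × Y) →ₗ[Λᵐᵒᵖ] A.car₁ := φ.h₁
    let p : ι →₀ X := Finsupp.mapRange.linearMap (LinearMap.fst Λᵐᵒᵖ X Y) v'
    let q : ι →₀ Y := Finsupp.mapRange.linearMap (LinearMap.snd Λᵐᵒᵖ X Y) v'
    have hv : v' = Finsupp.mapRange.linearMap (LinearMap.inl Λᵐᵒᵖ X Y) p +
        Finsupp.mapRange.linearMap (LinearMap.prod (0 : Y →ₗ[Λᵐᵒᵖ] X) LinearMap.id) q := by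
      ext i <;> simp [p, q]
    change φ₁ v' ∈ _
    rw [hv, map_add]
    refine Submodule.add_mem_sup ?_ ?_
    · exact range_le_iSup_range
        (φ₁ ∘ₗ Finsupp.mapRange.linearMap (LinearMap.inl Λᵐᵒᵖ X Y)) ⟨p, rfl⟩
    · exact ⟨φ.h₂ q, (φ.comm q).symm⟩
  · rintro ⟨h₂, h₁⟩
    rw [genMod_iff] at h₂
    let ι := (X →ₗ[Λᵐᵒᵖ] A.car₁) ⊕ (Y →ₗ[Λᵐᵒᵖ] A.car₂)
    let a : ι → X →ₗ[Λᵐᵒᵖ] A.car₁ := Sum.elim (fun f => f) 0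
    let b : ι → Y →ₗ[Λᵐᵒᵖ] A.car₂ := Sum.elim 0 (fun f => f)
    let c : ι → X × Y →ₗ[Λᵐᵒᵖ] A.car₁ := fun i => (a i).coprod (A.str ∘ₗ b i)
    have hb : ⨆ i, LinearMap.range (b i) = ⊤ := by
      rw [iSup_sum]
      exact top_le_iff.1 (h₂.ge.trans le_sup_right)
    have hc : ⨆ i, LinearMap.range (c i) = ⊤ := by
      simp only [c, LinearMap.range_coprod, iSup_sup_eq, LinearMap.range_comp]
      rw [← Submodule.map_iSup, hb, Submodule.map_top, eq_top_iff, ← h₁]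
      refine sup_le_sup_right ?_ _
      rw [iSup_sum]
      exact le_sup_left
    rw [← range_finsupp_lsum, LinearMap.range_eq_top] at hb hc
    refine ⟨ι, ⟨Finsupp.lsum ℕ c, Finsupp.lsum ℕ b, fun y => ?_⟩, hc, hb⟩
    have : Finsupp.lsum ℕ c ∘ₗ
        Finsupp.mapRange.linearMap (LinearMap.prod (0 : Y →ₗ[Λᵐᵒᵖ] X) LinearMap.id) =
        A.str ∘ₗ Finsupp.lsum ℕ b := by
      ext; simp [c]
    exact LinearMap.congr_fun this y

theorem tPairProjective_sumPair [Module.Projective Λᵐᵒᵖ X] [Module.Projective Λᵐᵒᵖ Y] :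
    TPairProjective (sumPair Λ X Y) := by
  intro B C g h₁ h₂ φ
  obtain ⟨a, ha⟩ := Module.projective_lifting_property g.h₁ (sumPairLeft φ) h₁
  obtain ⟨b, hb⟩ := Module.projective_lifting_property g.h₂ (sumPairRight φ) h₂
  refine ⟨sumPairDesc a b, ?_⟩
  rw [← sumPairDesc_left_right φ, ← ha, ← hb]
  refine TPairHom.ext (LinearMap.ext fun v => ?_) rfl
  change g.h₁ (a v.1 + B.str (b v.2)) = g.h₁ (a v.1) + C.str (g.h₂ (b v.2))
  rw [map_add, g.comm]

/-- The homomorphism `(a, 0) ⊕ (b, b)`. -/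
def sumPairMap {X' Y' : Type u} [AddCommGroup X'] [Module Λᵐᵒᵖ X'] [AddCommGroup Y']
    [Module Λᵐᵒᵖ Y'] (a : X →ₗ[Λᵐᵒᵖ] X') (b : Y →ₗ[Λᵐᵒᵖ] Y') :
    TPairHom Λ (sumPair Λ X Y) (sumPair Λ X' Y') where
  h₁ := a.prodMap b
  h₂ := b
  comm _ := Prod.ext (map_zero a) rfl

theorem dTPair_sumPairMap_iff {X' Y' : Type u} [AddCommGroup X'] [Module Λᵐᵒᵖ X']
    [AddCommGroup Y'] [Module Λᵐᵒᵖ Y'] (a : X →ₗ[Λᵐᵒᵖ] X') (b : Y →ₗ[Λᵐᵒᵖ] Y') (A : TPair Λ) :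
    DTPair (sumPairMap a b) A ↔ DMod a A.car₁ ∧ DMod b A.car₂ := by
  have key : ∀ (f : X' →ₗ[Λᵐᵒᵖ] A.car₁) (g : Y' →ₗ[Λᵐᵒᵖ] A.car₂),
      (sumPairDesc f g).comp (sumPairMap a b) = sumPairDesc (f ∘ₗ a) (g ∘ₗ b) :=
    fun f g => TPairHom.ext rfl rfl
  constructor
  · refine fun h => ⟨fun f => ?_, fun g => ?_⟩
    · obtain ⟨ψ, hψ⟩ := h (sumPairDesc f 0)
      rw [← sumPairDesc_left_right ψ, key] at hψ
      have := congrArg sumPairLeft hψ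
      rw [sumPairLeft_desc, sumPairLeft_desc] at this
      exact ⟨_, this⟩
    · obtain ⟨ψ, hψ⟩ := h (sumPairDesc 0 g)
      exact ⟨sumPairRight ψ, congrArg sumPairRight hψ⟩
  · rintro ⟨ha, hb⟩ φ
    obtain ⟨f, hf⟩ := ha (sumPairLeft φ)
    obtain ⟨g, hg⟩ := hb (sumPairRight φ)
    refine ⟨sumPairDesc f g, ?_⟩
    rw [key, hf, hg, sumPairDesc_left_right]

/-- If `X`, `Y` are silting and `Y ∈ Gen X`, then `(X, 0) ⊕ (Y, Y)_{id}` is silting. -/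
theorem IsSiltingMod.isSiltingTPair_sumPair (hX : IsSiltingMod Λᵐᵒᵖ X) (hY : IsSiltingMod Λᵐᵒᵖ Y)
    (h : GenMod Λᵐᵒᵖ X Y) : IsSiltingTPair (sumPair Λ X Y) := by
  obtain ⟨P₁, P₀, σ, π, _, _, hπ, hσ, hD⟩ := hX
  obtain ⟨Q₁, Q₀, τ, ρ, _, _, hρ, hτ, hE⟩ := hY
  refine ⟨_, _, sumPairMap σ τ, sumPairMap π ρ, tPairProjective_sumPair,
    tPairProjective_sumPair, hπ.prodMap hρ, hρ, ?_, hτ, fun A => ?_⟩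
  · rintro ⟨p, q⟩
    change (π p, ρ q) = (0, 0) ↔ ∃ v : P₁ × Q₁, (σ v.1, τ v.2) = (p, q)
    simp only [Prod.mk.injEq, hσ p, hτ q, Prod.exists, Set.mem_range]
    exact ⟨fun ⟨⟨a, ha⟩, b, hb⟩ => ⟨a, b, ha, hb⟩, fun ⟨a, b, ha, hb⟩ => ⟨⟨a, ha⟩, b, hb⟩⟩
  · rw [dTPair_sumPairMap_iff, genTPair_sumPair_iff, ← hD, ← hE, and_comm]
    refine and_congr_left fun h₂ => ?_
    rw [genMod_iff, sup_eq_left.2]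
    rw [LinearMap.range_eq_map, ← genMod_iff.1 h₂, Submodule.map_iSup]
    refine iSup_le fun f => ?_
    rw [← LinearMap.range_comp]
    exact h.range_le _

/-- The triple `(A, 0)`. -/
def leftPair (A : Type u) [AddCommGroup A] [Module Λᵐᵒᵖ A] : TPair Λ :=
  ⟨A, PUnit, 0⟩

/-- The triple `(0, A)`. -/
def rightPair (A : Type u) [AddCommGroup A] [Module Λᵐᵒᵖ A] : TPair Λ :=
  ⟨PUnit, A, 0⟩

variable {A : Type u} [AddCommGroup A] [Module Λᵐᵒᵖ A]

/-- A homomorphism to `(0, A)` is a homomorphism from the second component to `A`. -/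
def toRightPair {P : TPair Λ} (g : P.car₂ →ₗ[Λᵐᵒᵖ] A) : TPairHom Λ P (rightPair A) :=
  ⟨(0 : P.car₁ →ₗ[Λᵐᵒᵖ] PUnit.{u + 1}), g, fun _ => rfl⟩

/-- The cokernel of the structure map of a triple. -/
abbrev TPair.Coker (P : TPair Λ) : Type u := P.car₁ ⧸ LinearMap.range P.str

theorem TPair.comp_mkQ_str (P : TPair Λ) (g : P.Coker →ₗ[Λᵐᵒᵖ] A) (y : P.car₂) :
    (g ∘ₗ Submodule.mkQ _) (P.str y) = 0 := by
  have : Submodule.mkQ (LinearMap.range P.str) (P.str y) = 0 := by simp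
  rw [LinearMap.comp_apply, this, map_zero]

/-- A homomorphism to `(A, 0)` is a homomorphism from the cokernel of the structure map
to `A`. -/
def toLeftPair {P : TPair Λ} (g : P.Coker →ₗ[Λᵐᵒᵖ] A) : TPairHom Λ P (leftPair A) :=
  ⟨g ∘ₗ Submodule.mkQ _, (0 : P.car₂ →ₗ[Λᵐᵒᵖ] PUnit.{u + 1}), fun y => P.comp_mkQ_str g y⟩

/-- The homomorphism from the cokernel of the structure map induced by a homomorphism
to `(A, 0)`. -/
def ofLeftPair {P : TPair Λ} (φ : TPairHom Λ P (leftPair A)) : P.Coker →ₗ[Λᵐᵒᵖ] A :=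
  (LinearMap.range P.str).liftQ φ.h₁ <| by
    rintro _ ⟨y, rfl⟩
    exact φ.comm y

theorem toLeftPair_ofLeftPair {P : TPair Λ} (φ : TPairHom Λ P (leftPair A)) :
    toLeftPair (ofLeftPair φ) = φ :=
  TPairHom.ext rfl (LinearMap.ext fun _ => rfl)

theorem toLeftPair_injective {P : TPair Λ} :
    Injective (toLeftPair : (P.Coker →ₗ[Λᵐᵒᵖ] A) → TPairHom Λ P (leftPair A)) :=
  fun _ _ h => Submodule.linearMap_qext _ (congrArg TPairHom.h₁ h)

/-- The homomorphism induced on the cokernels of the structure maps. -/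
def TPairHom.coker {P Q : TPair Λ} (σ : TPairHom Λ P Q) : P.Coker →ₗ[Λᵐᵒᵖ] Q.Coker :=
  Submodule.mapQ _ _ σ.h₁ <| by
    rintro _ ⟨y, rfl⟩
    exact ⟨σ.h₂ y, (σ.comm y).symm⟩

theorem toLeftPair_comp {P Q : TPair Λ} (σ : TPairHom Λ P Q) (g : Q.Coker →ₗ[Λᵐᵒᵖ] A) :
    (toLeftPair g).comp σ = toLeftPair (g ∘ₗ σ.coker) :=
  TPairHom.ext rfl (LinearMap.ext fun _ => rfl)

theorem dTPair_leftPair_iff {P Q : TPair Λ} (σ : TPairHom Λ P Q) :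
    DTPair σ (leftPair A) ↔ DMod σ.coker A := by
  constructor
  · intro h g
    obtain ⟨ψ, hψ⟩ := h (toLeftPair g)
    rw [← toLeftPair_ofLeftPair ψ, toLeftPair_comp] at hψ
    exact ⟨_, toLeftPair_injective hψ⟩
  · intro h φ
    obtain ⟨g, hg⟩ := h (ofLeftPair φ)
    exact ⟨toLeftPair g, by rw [toLeftPair_comp, hg, toLeftPair_ofLeftPair]⟩

theorem dTPair_rightPair_iff {P Q : TPair Λ} (σ : TPairHom Λ P Q) :
    DTPair σ (rightPair A) ↔ DMod σ.h₂ A := by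
  constructor
  · intro h g
    obtain ⟨ψ, hψ⟩ := h (toRightPair g)
    exact ⟨ψ.h₂, congrArg TPairHom.h₂ hψ⟩
  · intro h φ
    obtain ⟨g, hg⟩ := h φ.h₂
    exact ⟨toRightPair g, TPairHom.ext (LinearMap.ext fun _ => rfl) hg⟩

theorem genTPair_leftPair_iff :
    GenTPair (sumPair Λ X Y) (leftPair A) ↔ GenMod Λᵐᵒᵖ X A := by
  have h₂ : GenMod Λᵐᵒᵖ Y (leftPair (Λ := Λ) A).car₂ :=
    ⟨PUnit, (0 : (PUnit →₀ Y) →ₗ[Λᵐᵒᵖ] PUnit.{u + 1}), fun _ => ⟨0, rfl⟩⟩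
  have h₁ : LinearMap.range (leftPair (Λ := Λ) A).str = ⊥ := LinearMap.range_zero
  rw [genTPair_sumPair_iff, and_iff_right h₂, h₁, sup_bot_eq, genMod_iff]
  rfl

theorem genTPair_rightPair_iff :
    GenTPair (sumPair Λ X Y) (rightPair A) ↔ GenMod Λᵐᵒᵖ Y A := by
  have : Subsingleton (Submodule Λᵐᵒᵖ (rightPair (Λ := Λ) A).car₁) :=
    inferInstanceAs (Subsingleton (Submodule Λᵐᵒᵖ PUnit.{u + 1}))
  rw [genTPair_sumPair_iff, and_iff_left (Subsingleton.elim _ _)]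
  rfl

theorem TPairProjective.projective_car₂ {P : TPair Λ} (hP : TPairProjective P) :
    Module.Projective Λᵐᵒᵖ P.car₂ := by
  refine Module.Projective.of_lifting_property'' fun f hf => ?_
  let g : TPairHom Λ (rightPair (P.car₂ →₀ Λᵐᵒᵖ)) (rightPair P.car₂) :=
    ⟨(0 : PUnit.{u + 1} →ₗ[Λᵐᵒᵖ] PUnit.{u + 1}), f, fun _ => rfl⟩
  obtain ⟨ψ, hψ⟩ := hP _ _ g (fun x => ⟨x, rfl⟩) hf (toRightPair LinearMap.id)
  exact ⟨ψ.h₂, congrArg TPairHom.h₂ hψ⟩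

theorem TPairProjective.projective_coker {P : TPair Λ} (hP : TPairProjective P) :
    Module.Projective Λᵐᵒᵖ P.Coker := by
  refine Module.Projective.of_lifting_property'' fun f hf => ?_
  let g : TPairHom Λ (leftPair (P.Coker →₀ Λᵐᵒᵖ)) (leftPair P.Coker) :=
    ⟨f, (0 : PUnit.{u + 1} →ₗ[Λᵐᵒᵖ] PUnit.{u + 1}), fun _ => map_zero f⟩
  obtain ⟨ψ, hψ⟩ := hP _ _ g hf (fun x => ⟨x, rfl⟩) (toLeftPair LinearMap.id)
  refine ⟨ofLeftPair ψ, toLeftPair_injective ?_⟩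
  rw [← hψ]
  exact TPairHom.ext rfl (LinearMap.ext fun _ => rfl)

/-- If `(X, 0) ⊕ (Y, Y)_{id}` lies in `D_σ` for a presentation `σ` of itself, then
so does `(Y, 0)`, i.e. `Y` lies in `D` of the map induced by `σ` on cokernels. -/
theorem dMod_coker_of_dTPair_sumPair {P₁ P₀ : TPair Λ} {σ : TPairHom Λ P₁ P₀}
    {π : TPairHom Λ P₀ (sumPair Λ X Y)} (hσ₁ : Function.Exact σ.h₁ π.h₁)
    (hσ₂ : Function.Exact σ.h₂ π.h₂) (hπ₂ : Surjective π.h₂)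
    (h : DTPair σ (sumPair Λ X Y)) : DMod σ.coker Y := by
  intro g
  let q : P₁.car₁ →ₗ[Λᵐᵒᵖ] Y := g ∘ₗ Submodule.mkQ _
  obtain ⟨ψ, hψ⟩ := h ⟨LinearMap.inr Λᵐᵒᵖ X Y ∘ₗ q, (0 : P₁.car₂ →ₗ[Λᵐᵒᵖ] Y), fun y =>
    Prod.ext rfl (P₁.comp_mkQ_str g y)⟩
  let ψ₂ : P₀.car₂ →ₗ[Λᵐᵒᵖ] Y := ψ.h₂
  let ψ₁ : P₀.car₁ →ₗ[Λᵐᵒᵖ] Y := LinearMap.snd Λᵐᵒᵖ X Y ∘ₗ ψ.h₁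
  let π₁ : P₀.car₁ →ₗ[Λᵐᵒᵖ] Y := LinearMap.snd Λᵐᵒᵖ X Y ∘ₗ π.h₁
  have hψσ₁ : ∀ p, ψ₁ (σ.h₁ p) = q p := fun p =>
    congrArg Prod.snd (LinearMap.congr_fun (congrArg TPairHom.h₁ hψ) p)
  have hψσ₂ : ∀ p, ψ₂ (σ.h₂ p) = 0 := fun p =>
    LinearMap.congr_fun (congrArg TPairHom.h₂ hψ) p
  have hψstr : ∀ y, ψ₁ (P₀.str y) = ψ₂ y := fun y => congrArg Prod.snd (ψ.comm y)
  have hπstr : ∀ y, π₁ (P₀.str y) = π.h₂ y := fun y => congrArg Prod.snd (π.comm y)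
  have hπσ : ∀ p, π₁ (σ.h₁ p) = 0 := fun p => congrArg Prod.snd ((hσ₁ _).2 ⟨p, rfl⟩)
  have hker : LinearMap.ker π.h₂ ≤ LinearMap.ker ψ₂ := by
    intro y hy
    obtain ⟨z, rfl⟩ := (hσ₂ y).1 hy
    exact hψσ₂ z
  let π₂ : P₀.car₂ →ₗ[Λᵐᵒᵖ] Y := π.h₂
  let u : Y →ₗ[Λᵐᵒᵖ] Y := (LinearMap.ker π₂).liftQ ψ₂ hker ∘ₗ
    (π₂.quotKerEquivOfSurjective hπ₂).symm.toLinearMap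
  have hu : ∀ y, u (π₂ y) = ψ₂ y := fun y => by
    have : (π₂.quotKerEquivOfSurjective hπ₂).symm (π₂ y) = Submodule.Quotient.mk y := by
      rw [LinearEquiv.symm_apply_eq]; rfl
    simp only [u, LinearMap.comp_apply, LinearEquiv.coe_coe, this]
    rfl
  refine ⟨(LinearMap.range P₀.str).liftQ (ψ₁ - u ∘ₗ π₁) ?_, ?_⟩
  · rintro _ ⟨y, rfl⟩
    change ψ₁ (P₀.str y) - u (π₁ (P₀.str y)) = 0
    rw [hψstr, hπstr, ← hu]
    exact sub_self _
  · refine Submodule.linearMap_qext _ (LinearMap.ext fun p => ?_)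
    change ψ₁ (σ.h₁ p) - u (π₁ (σ.h₁ p)) = q p
    rw [hψσ₁, hπσ, map_zero, sub_zero]

theorem IsSiltingTPair.of_sumPair (h : IsSiltingTPair (sumPair Λ X Y)) :
    IsSiltingMod Λᵐᵒᵖ X ∧ IsSiltingMod Λᵐᵒᵖ Y ∧ GenMod Λᵐᵒᵖ X Y := by
  obtain ⟨P₁, P₀, σ, π, hP₁, hP₀, hπ₁, hπ₂, hσ₁, hσ₂, hD⟩ := h
  have hX : ∀ (A : Type u) [AddCommGroup A] [Module Λᵐᵒᵖ A],
      GenMod Λᵐᵒᵖ X A ↔ DMod σ.coker A := fun A _ _ => by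
    rw [← dTPair_leftPair_iff, ← hD, genTPair_leftPair_iff]
  have hY : ∀ (A : Type u) [AddCommGroup A] [Module Λᵐᵒᵖ A],
      GenMod Λᵐᵒᵖ Y A ↔ DMod σ.h₂ A := fun A _ _ => by
    rw [← dTPair_rightPair_iff, ← hD, genTPair_rightPair_iff]
  let ρ : P₀.Coker →ₗ[Λᵐᵒᵖ] X :=
    (LinearMap.range P₀.str).liftQ (LinearMap.fst Λᵐᵒᵖ X Y ∘ₗ π.h₁) <| by
      rintro _ ⟨y, rfl⟩
      exact congrArg Prod.fst (π.comm y)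
  refine ⟨⟨ModuleCat.of _ P₁.Coker, ModuleCat.of _ P₀.Coker, σ.coker, ρ,
    hP₁.projective_coker, hP₀.projective_coker, fun x => ?_, fun p => ?_, hX⟩,
    ⟨ModuleCat.of _ P₁.car₂, ModuleCat.of _ P₀.car₂, σ.h₂, π.h₂, hP₁.projective_car₂,
      hP₀.projective_car₂, hπ₂, hσ₂, hY⟩, ?_⟩
  · obtain ⟨p, hp⟩ := hπ₁ ((x, 0) : X × Y)
    exact ⟨Submodule.Quotient.mk p, congrArg Prod.fst hp⟩
  · obtain ⟨p, rfl⟩ := Submodule.Quotient.mk_surjective _ p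
    constructor
    · intro hp
      obtain ⟨q, hq⟩ := hπ₂ (π.h₁ p : X × Y).2
      have hpq : π.h₁ (p - P₀.str q) = 0 := by
        rw [map_sub, π.comm, hq]
        refine sub_eq_zero.2 (Prod.ext hp rfl)
      obtain ⟨r, hr⟩ := (hσ₁ _).1 hpq
      refine ⟨Submodule.Quotient.mk r, ?_⟩
      change Submodule.Quotient.mk (σ.h₁ r) = _
      rw [hr, Submodule.Quotient.eq]
      exact ⟨-q, by simp⟩
    · rintro ⟨r, hr⟩
      obtain ⟨r, rfl⟩ := Submodule.Quotient.mk_surjective _ r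
      rw [← hr]
      exact congrArg Prod.fst ((hσ₁ _).2 ⟨r, rfl⟩)
  · rw [hX]
    exact dMod_coker_of_dTPair_sumPair hσ₁ hσ₂ hπ₂ ((hD _).1 (genTPair_refl _))

end SiltingTriples

/-- Corollary 3.9, silting case.  For `R = (Λ 0; Λ Λ)`, the right
`R`-module `(X, 0) ⊕ (Y, Y)_{id}` is silting iff both `X` and `Y` are silting right
`Λ`-modules and `Y ∈ Gen X`. -/
theorem stmt10
    {Λ : Type u} [Ring Λ]
    (X Y : Type u) [AddCommGroup X] [Module Λᵐᵒᵖ X] [AddCommGroup Y] [Module Λᵐᵒᵖ Y] :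
    IsSiltingTPair (sumPair Λ X Y) ↔
      IsSiltingMod Λᵐᵒᵖ X ∧ IsSiltingMod Λᵐᵒᵖ Y ∧ GenMod Λᵐᵒᵖ X Y := by
  exact ⟨IsSiltingTPair.of_sumPair, fun ⟨hX, hY, h⟩ => hX.isSiltingTPair_sumPair hY h⟩
end

section
/- Let Λ be a ring and R = (Λ 0; Λ Λ) the triangular matrix ring with M = Λ the regular (Λ,Λ)-bimodule. For right Λ-modules X and Y, the right R-module (X, 0) ⊕ (Y, Y)_{id} is a tilting R-module if and only if both X and Y are tilting right Λ-modules and Y ∈ Gen X. -/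
set_option linter.unusedSectionVars false

/-!
Framework for right modules over the triangular matrix ring `R = (Λ 0; Λ Λ)`.
Right `S`-modules are encoded as modules over the opposite ring `Sᵐᵒᵖ`.  Using the
identification `Y ⊗_Λ Λ ≅ Y`, a right `R`-module is encoded as a triple `(X, Y)_f`
where `X`, `Y` are right `Λ`-modules and `f : Y → X` is `Λ`-linear (`TPair`), with
morphisms `(α, β)` satisfying `α ∘ f = f' ∘ β`.
-/

open Function

universe u

section GenLemmas

variable {S : Type u} [Ring S] {X Y A B : Type u}
  [AddCommGroup X] [Module S X] [AddCommGroup Y] [Module S Y]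
  [AddCommGroup A] [Module S A] [AddCommGroup B] [Module S B]

theorem GenMod.self (T : Type u) [AddCommGroup T] [Module S T] : GenMod S T T :=
  ⟨PUnit, Finsupp.lapply PUnit.unit, fun t => ⟨Finsupp.single PUnit.unit t, by simp⟩⟩

theorem GenMod.trans (hXY : GenMod S X Y) (hYB : GenMod S Y B) : GenMod S X B := by
  obtain ⟨ι, φ, hφ⟩ := hXY
  obtain ⟨κ, ψ, hψ⟩ := hYB
  refine ⟨κ × ι, ψ ∘ₗ Finsupp.mapRange.linearMap φ ∘ₗ
    (Finsupp.curryLinearEquiv S).toLinearMap, ?_⟩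
  simp only [LinearMap.coe_comp, LinearEquiv.coe_coe]
  exact hψ.comp ((Finsupp.mapRange_surjective φ (map_zero φ) hφ).comp (LinearEquiv.surjective _))

theorem GenMod.of_subsingleton [Subsingleton B] : GenMod S X B :=
  ⟨PUnit, 0, fun _ => ⟨0, Subsingleton.elim _ _⟩⟩

/-- A module that is the sum of the images of two modules in `Gen X` is in `Gen X`. -/
theorem GenMod.of_add (hB : GenMod S X B) {ι : Type u} (a : (ι →₀ X) →ₗ[S] A)
    (g : B →ₗ[S] A) (h : ∀ z, ∃ w b, a w + g b = z) : GenMod S X A := by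
  obtain ⟨κ, β, hβ⟩ := hB
  refine ⟨ι ⊕ κ, (a.coprod (g ∘ₗ β)) ∘ₗ
    (Finsupp.sumFinsuppLEquivProdFinsupp S).toLinearMap, fun z => ?_⟩
  obtain ⟨w, b, rfl⟩ := h z
  obtain ⟨v, rfl⟩ := hβ b
  exact ⟨(Finsupp.sumFinsuppLEquivProdFinsupp S).symm (w, v), by simp⟩

theorem Ext1VanishMod.of_subsingleton [Subsingleton B] : Ext1VanishMod S X B := by
  intro E _ _ i p _ hp hip
  have hinj : Injective p := by
    rw [injective_iff_map_eq_zero]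
    intro e he
    obtain ⟨b, rfl⟩ := (hip e).1 he
    rw [Subsingleton.elim b 0, map_zero]
  exact ⟨(LinearEquiv.ofBijective p ⟨hinj, hp⟩).symm.toLinearMap,
    LinearMap.ext fun x => (LinearEquiv.ofBijective p ⟨hinj, hp⟩).apply_symm_apply x⟩

end GenLemmas

section SumPair

variable {Λ : Type u} [Ring Λ] {X Y : Type u}
  [AddCommGroup X] [Module Λᵐᵒᵖ X] [AddCommGroup Y] [Module Λᵐᵒᵖ Y]

/-- `(A, B)_g` lies in `Gen ((X, 0) ⊕ (Y, Y)_{id})` iff `B ∈ Gen Y` and `A` is the sum of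
`g(B)` and of the image of a direct sum of copies of `X`. -/
theorem genTPair_sumPair_iff_s11 (N : TPair Λ) :
    GenTPair (sumPair Λ X Y) N ↔
      GenMod Λᵐᵒᵖ Y N.car₂ ∧
        ∃ (ι : Type u) (a : (ι →₀ X) →ₗ[Λᵐᵒᵖ] N.car₁), ∀ z, ∃ w b, a w + N.str b = z := by
  constructor
  · rintro ⟨ι, ⟨h₁, h₂, comm⟩, hs₁, hs₂⟩
    change (ι →₀ X × Y) →ₗ[Λᵐᵒᵖ] N.car₁ at h₁
    change (ι →₀ Y) →ₗ[Λᵐᵒᵖ] N.car₂ at h₂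
    change ∀ y : ι →₀ Y, h₁ (Finsupp.mapRange.linearMap (LinearMap.prod (0 : Y →ₗ[Λᵐᵒᵖ] X) LinearMap.id) y) =
      N.str (h₂ y) at comm
    refine ⟨⟨ι, h₂, hs₂⟩, ι, h₁ ∘ₗ Finsupp.mapRange.linearMap (LinearMap.inl _ X Y), fun z => ?_⟩
    obtain ⟨w, rfl⟩ := hs₁ z
    change ι →₀ X × Y at w
    refine ⟨Finsupp.mapRange.linearMap (LinearMap.fst Λᵐᵒᵖ X Y) w,
      h₂ (Finsupp.mapRange.linearMap (LinearMap.snd Λᵐᵒᵖ X Y) w), ?_⟩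
    rw [← comm, LinearMap.comp_apply, ← map_add]
    change h₁ _ = h₁ w
    congr 1
    ext j <;> simp
  · rintro ⟨⟨κ, β, hβ⟩, ι, a, ha⟩
    let e : ((ι ⊕ κ) →₀ Y) ≃ₗ[Λᵐᵒᵖ] _ := Finsupp.sumFinsuppLEquivProdFinsupp Λᵐᵒᵖ
    let e' : ((ι ⊕ κ) →₀ X) ≃ₗ[Λᵐᵒᵖ] _ := Finsupp.sumFinsuppLEquivProdFinsupp Λᵐᵒᵖ
    let h₂ : ((ι ⊕ κ) →₀ Y) →ₗ[Λᵐᵒᵖ] N.car₂ := β ∘ₗ LinearMap.snd _ _ _ ∘ₗ e.toLinearMap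
    let h₁ : ((ι ⊕ κ) →₀ X × Y) →ₗ[Λᵐᵒᵖ] N.car₁ :=
      a ∘ₗ LinearMap.fst _ _ _ ∘ₗ e'.toLinearMap ∘ₗ
        Finsupp.mapRange.linearMap (LinearMap.fst _ X Y) +
      N.str ∘ₗ h₂ ∘ₗ Finsupp.mapRange.linearMap (LinearMap.snd _ X Y)
    have comm : ∀ y : (ι ⊕ κ) →₀ Y,
        h₁ (Finsupp.mapRange.linearMap (LinearMap.prod (0 : Y →ₗ[Λᵐᵒᵖ] X) LinearMap.id) y) = N.str (h₂ y) := by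
      intro y
      have e₁ : Finsupp.mapRange.linearMap (LinearMap.fst Λᵐᵒᵖ X Y)
          (Finsupp.mapRange.linearMap (LinearMap.prod (0 : Y →ₗ[Λᵐᵒᵖ] X) LinearMap.id) y) = 0 := by
        ext j; simp
      have e₂ : Finsupp.mapRange.linearMap (LinearMap.snd Λᵐᵒᵖ X Y)
          (Finsupp.mapRange.linearMap (LinearMap.prod (0 : Y →ₗ[Λᵐᵒᵖ] X) LinearMap.id) y) = y := by
        ext j; simp
      simp only [h₁, LinearMap.add_apply, LinearMap.comp_apply, e₁, e₂, map_zero, zero_add]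
    refine ⟨ι ⊕ κ, ⟨h₁, h₂, comm⟩, fun z => ?_, fun b => ?_⟩
    · obtain ⟨w, b, rfl⟩ := ha z
      obtain ⟨v, rfl⟩ := hβ b
      let t : (ι ⊕ κ) →₀ X × Y :=
        Finsupp.mapRange.linearMap (LinearMap.inl Λᵐᵒᵖ X Y) (e'.symm (w, 0)) +
          Finsupp.mapRange.linearMap (LinearMap.inr Λᵐᵒᵖ X Y) (e.symm (0, v))
      have t₁ : Finsupp.mapRange.linearMap (LinearMap.fst Λᵐᵒᵖ X Y) t = e'.symm (w, 0) := by
        ext j; simp [t]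
      have t₂ : Finsupp.mapRange.linearMap (LinearMap.snd Λᵐᵒᵖ X Y) t = e.symm (0, v) := by
        ext j; simp [t]
      refine ⟨t, ?_⟩
      change h₁ t = _
      simp only [h₁, h₂, LinearMap.add_apply, LinearMap.comp_apply, t₁, t₂, LinearEquiv.coe_coe,
        LinearEquiv.apply_symm_apply, LinearMap.fst_apply, LinearMap.snd_apply]
    · obtain ⟨v, rfl⟩ := hβ b
      refine ⟨e.symm (0, v), ?_⟩
      change h₂ (e.symm (0, v)) = _
      simp [h₂]

theorem Ext1VanishTPair.fst {N : TPair Λ} (h : Ext1VanishTPair (sumPair Λ X Y) N) :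
    Ext1VanishMod Λᵐᵒᵖ X N.car₁ := by
  intro E _ _ i p hi hp hip
  obtain ⟨⟨s₁, s₂, hs⟩, hs'⟩ := h
    ⟨E × Y, N.car₂ × Y, LinearMap.prodMap (i ∘ₗ N.str) LinearMap.id⟩
    ⟨LinearMap.inl _ _ _ ∘ₗ i, LinearMap.inl _ _ _, fun y => by simp⟩
    ⟨LinearMap.prodMap p LinearMap.id, LinearMap.snd Λᵐᵒᵖ N.car₂ Y, fun y =>
      Prod.ext ((hip (i (N.str y.1))).2 ⟨_, rfl⟩) rfl⟩
    (LinearMap.inl_injective.comp hi)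
    LinearMap.inl_injective
    (fun z => by
      obtain ⟨e, he⟩ := hp z.1
      exact ⟨(e, z.2), Prod.ext he rfl⟩)
    (fun y => ⟨(0, y), rfl⟩)
    (fun z => by
      constructor
      · intro hz
        have hz₁ : p z.1 = 0 := congrArg Prod.fst hz
        have hz₂ : z.2 = 0 := congrArg Prod.snd hz
        obtain ⟨a, ha⟩ := (hip _).1 hz₁
        exact ⟨a, Prod.ext ha hz₂.symm⟩
      · rintro ⟨a, rfl⟩
        exact Prod.ext ((hip _).2 ⟨a, rfl⟩) rfl)
    (fun z => by
      constructor
      · intro hz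
        exact ⟨z.1, Prod.ext rfl (Eq.symm hz)⟩
      · rintro ⟨a, rfl⟩
        rfl)
  change X × Y →ₗ[Λᵐᵒᵖ] E × Y at s₁
  have key : ∀ z : X × Y, ((p (s₁ z).1, (s₁ z).2) : X × Y) = z := fun z =>
    congrArg (fun f : TPairHom Λ (sumPair Λ X Y) (sumPair Λ X Y) => f.h₁ z) hs'
  exact ⟨LinearMap.fst _ _ _ ∘ₗ s₁ ∘ₗ LinearMap.inl _ _ _,
    LinearMap.ext fun x => congrArg Prod.fst (key (x, 0))⟩

theorem Ext1VanishTPair.snd {N : TPair Λ} (h : Ext1VanishTPair (sumPair Λ X Y) N) :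
    Ext1VanishMod Λᵐᵒᵖ Y N.car₂ := by
  intro E _ _ i p hi hp hip
  -- the pushout of `E` along the structure map of `N`
  let K : Submodule Λᵐᵒᵖ (N.car₁ × E) := LinearMap.range (LinearMap.prod N.str (-i))
  let q : (N.car₁ × E) →ₗ[Λᵐᵒᵖ] (N.car₁ × E) ⧸ K := K.mkQ
  have hpi : ∀ b, p (i b) = 0 := fun b => (hip _).2 ⟨b, rfl⟩
  have hK : K ≤ LinearMap.ker (p ∘ₗ LinearMap.snd Λᵐᵒᵖ N.car₁ E) := by
    rintro _ ⟨b, rfl⟩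
    simp [hpi]
  let p' : ((N.car₁ × E) ⧸ K) →ₗ[Λᵐᵒᵖ] Y := K.liftQ _ hK
  have hp' : ∀ z, p' (q z) = p z.2 := fun z => rfl
  have hq : ∀ b, q (N.str b, 0) = q (0, i b) := fun b =>
    (Submodule.Quotient.eq K).2 ⟨b, by simp⟩
  have hq_inj : ∀ a, q (a, 0) = 0 → a = 0 := by
    intro a ha
    obtain ⟨b, hb⟩ := (Submodule.Quotient.mk_eq_zero K).1 ha
    have hb₁ : N.str b = a := congrArg Prod.fst hb
    have hb₂ : -i b = 0 := congrArg Prod.snd hb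
    have : b = 0 := hi (by rw [map_zero]; exact neg_eq_zero.1 hb₂)
    rw [← hb₁, this, map_zero]
  have hq_surj : Surjective q := K.mkQ_surjective
  obtain ⟨⟨s₁, s₂, hs⟩, hs'⟩ := h
    ⟨X × ((N.car₁ × E) ⧸ K), E, LinearMap.inr _ _ _ ∘ₗ q ∘ₗ LinearMap.inr _ _ _⟩
    ⟨LinearMap.inr _ _ _ ∘ₗ q ∘ₗ LinearMap.inl _ _ _, i, fun y => Prod.ext rfl (hq y)⟩
    ⟨LinearMap.prodMap LinearMap.id p', p, fun y => rfl⟩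
    (LinearMap.inr_injective.comp ((injective_iff_map_eq_zero (q ∘ₗ LinearMap.inl _ _ _)).2 hq_inj))
    hi
    (fun z => by
      obtain ⟨e, he⟩ := hp z.2
      exact ⟨(z.1, q (0, e)), Prod.ext rfl he⟩)
    hp
    (fun z => by
      constructor
      · intro hz
        obtain ⟨x, z⟩ := z
        obtain ⟨⟨a, e⟩, rfl⟩ := hq_surj z
        have hz₁ : x = 0 := congrArg Prod.fst hz
        have hz₂ : p e = 0 := congrArg Prod.snd hz
        obtain ⟨b, rfl⟩ := (hip _).1 hz₂
        refine ⟨a + N.str b, Prod.ext hz₁.symm ?_⟩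
        change q (a + N.str b, 0) = q (a, i b)
        have e₁ : ((a + N.str b, 0) : N.car₁ × E) = (a, 0) + (N.str b, 0) := by simp
        have e₂ : ((a, i b) : N.car₁ × E) = (a, 0) + (0, i b) := by simp
        rw [e₁, e₂, map_add, map_add, hq]
      · rintro ⟨a, rfl⟩
        exact Prod.ext rfl (map_zero p))
    hip
  exact ⟨s₂, LinearMap.ext fun y =>
    congrArg (fun f : TPairHom Λ (sumPair Λ X Y) (sumPair Λ X Y) => f.h₂ y) hs'⟩

theorem ext1VanishTPair_sumPair_of {N : TPair Λ} (hX : Ext1VanishMod Λᵐᵒᵖ X N.car₁)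
    (hY : Ext1VanishMod Λᵐᵒᵖ Y N.car₂) : Ext1VanishTPair (sumPair Λ X Y) N := by
  rintro E ⟨i₁, i₂, hi⟩ ⟨p₁, p₂, hp⟩ hi₁ hi₂ hp₁ hp₂ he₁ he₂
  change E.car₁ →ₗ[Λᵐᵒᵖ] X × Y at p₁
  change E.car₂ →ₗ[Λᵐᵒᵖ] Y at p₂
  change ∀ y, p₁ (E.str y) = (0, p₂ y) at hp
  change Surjective p₁ at hp₁
  change Function.Exact i₁ p₁ at he₁
  change Injective i₁ at hi₁
  obtain ⟨s₂, hs₂⟩ := hY E.car₂ i₂ p₂ hi₂ hp₂ he₂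
  let F : Submodule Λᵐᵒᵖ E.car₁ := LinearMap.ker (LinearMap.snd _ _ _ ∘ₗ p₁)
  have hiF : ∀ a, i₁ a ∈ F := fun a => congrArg Prod.snd ((he₁ _).2 ⟨a, rfl⟩)
  obtain ⟨s, hs⟩ := hX F (i₁.codRestrict F hiF) (LinearMap.fst _ _ _ ∘ₗ p₁ ∘ₗ F.subtype)
    (fun a b hab => hi₁ (congrArg Subtype.val hab))
    (fun x => by
      obtain ⟨e, he⟩ := hp₁ (x, 0)
      exact ⟨⟨e, congrArg Prod.snd he⟩, congrArg Prod.fst he⟩)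
    (fun e => by
      constructor
      · intro h
        obtain ⟨a, ha⟩ := (he₁ e.1).1 (Prod.ext h e.2)
        exact ⟨a, Subtype.ext ha⟩
      · rintro ⟨a, rfl⟩
        exact congrArg Prod.fst ((he₁ _).2 ⟨a, rfl⟩))
  have hps : ∀ x, p₁ (s x) = (x, 0) := fun x => Prod.ext (LinearMap.congr_fun hs x) (s x).2
  have hps₂ : ∀ y, p₂ (s₂ y) = y := LinearMap.congr_fun hs₂
  let s₁ : X × Y →ₗ[Λᵐᵒᵖ] E.car₁ := (F.subtype ∘ₗ s).coprod (E.str ∘ₗ s₂)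
  have hs₁ : p₁ ∘ₗ s₁ = LinearMap.id := by
    refine LinearMap.ext fun z => ?_
    simp [s₁, hps, hp, hps₂]
  refine ⟨⟨s₁, s₂, fun y => ?_⟩, ?_⟩
  · change s₁ (0, y) = _
    simp only [s₁, LinearMap.coprod_apply, map_zero, zero_add]
    rfl
  · unfold TPairHom.comp TPairHom.id
    congr 1

/-- `Ext¹((X, 0) ⊕ (Y, Y)_{id}, (A, B)_g) = 0` iff `Ext¹(X, A) = 0` and `Ext¹(Y, B) = 0`. -/
theorem ext1VanishTPair_sumPair_iff (N : TPair Λ) :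
    Ext1VanishTPair (sumPair Λ X Y) N ↔
      Ext1VanishMod Λᵐᵒᵖ X N.car₁ ∧ Ext1VanishMod Λᵐᵒᵖ Y N.car₂ :=
  ⟨fun h => ⟨h.fst, h.snd⟩, fun h => ext1VanishTPair_sumPair_of h.1 h.2⟩

end SumPair

/-- Corollary 3.9, tilting case.  For `R = (Λ 0; Λ Λ)`, the right
`R`-module `(X, 0) ⊕ (Y, Y)_{id}` is tilting iff both `X` and `Y` are tilting right
`Λ`-modules and `Y ∈ Gen X`. -/
theorem stmt11
    {Λ : Type u} [Ring Λ]
    (X Y : Type u) [AddCommGroup X] [Module Λᵐᵒᵖ X] [AddCommGroup Y] [Module Λᵐᵒᵖ Y] :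
    IsTiltingTPair (sumPair Λ X Y) ↔
      IsTiltingMod Λᵐᵒᵖ X ∧ IsTiltingMod Λᵐᵒᵖ Y ∧ GenMod Λᵐᵒᵖ X Y := by
  unfold IsTiltingTPair
  simp only [genTPair_sumPair_iff_s11, ext1VanishTPair_sumPair_iff]
  constructor
  · intro h
    have hX : IsTiltingMod Λᵐᵒᵖ X := by
      intro A _ _
      have hA := h ⟨A, PUnit, 0⟩
      constructor
      · rintro ⟨ι, φ, hφ⟩
        exact (hA.1 ⟨GenMod.of_subsingleton, ι, φ, fun z =>
          (hφ z).imp fun w hw => ⟨0, by simpa using hw⟩⟩).1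
      · intro hExt
        obtain ⟨-, ι, a, ha⟩ := hA.2 ⟨hExt, Ext1VanishMod.of_subsingleton⟩
        refine ⟨ι, a, fun z => ?_⟩
        obtain ⟨w, b, hw⟩ := ha z
        exact ⟨w, by simpa using hw⟩
    refine ⟨hX, fun B _ _ => ?_, ?_⟩
    · have hB := h ⟨PUnit, B, 0⟩
      exact ⟨fun hGen => (hB.1 ⟨hGen, PUnit, 0, fun z => ⟨0, 0, Subsingleton.elim _ _⟩⟩).2,
        fun hExt => (hB.2 ⟨Ext1VanishMod.of_subsingleton, hExt⟩).1⟩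
    · exact (hX Y).2 ((h ⟨Y, Y, LinearMap.id⟩).1
        ⟨GenMod.self Y, PUnit, 0, fun z => ⟨0, z, by simp⟩⟩).1
  · rintro ⟨hX, hY, hXY⟩ N
    rw [← hX, ← hY]
    constructor
    · rintro ⟨hB, ι, a, ha⟩
      exact ⟨(hXY.trans hB).of_add a N.str ha, hB⟩
    · rintro ⟨⟨ι, a, ha⟩, hB⟩
      exact ⟨hB, ι, a, fun z => (ha z).imp fun w hw => ⟨0, by simpa using hw⟩⟩
end
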